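/- arXiv:1803.06101 — 3 statements merged into one kernel-verified Lean document; each statement's English description precedes it below -/
import Mathlib

section
/- Let γ_1 ≥ γ_2 ≥ ⋯ be a nonincreasing sequence of positive reals defining product weights γ_u = ∏_{j∈u} γ_j. For N ≥ 4 define δ*(N) = (log log N + log 6) / (2·log log N + log 6 − 1 − log(2·log log N + log 6 − 1)). Then for every dimension d ≥ 1 and every integer N ≥ 4, D*_{N,γ}(H_{d,N}) ≤ N^{−(1−δ*(N))} · max_{∅≠u⊆{1,…,d}} ∏_{j∈u} (j·γ_j). -/
open Finset Real

noncomputable section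

/-- Radical inverse function in base `b`: if `n = ∑ nᵢ bⁱ` then `radInv b n = ∑ nᵢ b^{-i-1}`. -/
def radInv (b n : ℕ) : ℝ := ∑' i : ℕ, (((n / b ^ i) % b : ℕ) : ℝ) / (b : ℝ) ^ (i + 1)

/-- `n`-th point of the `d`-dimensional Halton sequence; coordinate `j` (0-based)
uses the `(j+1)`-st prime (`Nat.nth Nat.Prime 0 = 2`). -/
def halton (d n : ℕ) : Fin d → ℝ := fun j => radInv (Nat.nth Nat.Prime j) n

open scoped Classical in
/-- Star discrepancy of the point set `P` of `N` points with coordinates indexed by `ι`: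
`D*_N(P) = sup_{α ∈ [0,1]^ι} |#{n : P n ∈ [0,α)}/N − ∏ᵢ αᵢ|`. -/
def starDisc {ι : Type} [Fintype ι] (N : ℕ) (P : Fin N → ι → ℝ) : ℝ :=
  sSup {t : ℝ | ∃ α : ι → ℝ, (∀ i, 0 ≤ α i ∧ α i ≤ 1) ∧
    t = |((Finset.univ.filter fun n : Fin N => ∀ i, 0 ≤ P n i ∧ P n i < α i).card : ℝ) / N
          - ∏ i, α i|}

/-- Star discrepancy of the projection of the first `N` points of the `d`-dimensional
Halton sequence onto the coordinates in `u`. -/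
def haltonProjStarDisc (d N : ℕ) (u : Finset (Fin d)) : ℝ :=
  starDisc N fun n (i : u) => halton d n i.1

/-- Weighted star discrepancy, for product weights built from `γ : ℕ → ℝ` (1-based:
coordinate `j : Fin d` carries weight `γ (j+1)`), of the first `N` points of the
`d`-dimensional Halton sequence:
`max_{∅ ≠ u ⊆ [d]} (∏_{j ∈ u} γ_j) · D*_N(H_{d,N}(u))`. -/
def wHaltonStarDisc (γ : ℕ → ℝ) (d N : ℕ) : ℝ :=
  sSup {t : ℝ | ∃ u : Finset (Fin d), u.Nonempty ∧
    t = (∏ j ∈ u, γ (j.1 + 1)) * haltonProjStarDisc d N u}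

/-- `δ*(N) = (log log N + log 6)/(2·log log N + log 6 − 1 − log(2·log log N + log 6 − 1))`. -/
def deltaStar (N : ℕ) : ℝ :=
  (Real.log (Real.log N) + Real.log 6) /
    (2 * Real.log (Real.log N) + Real.log 6 - 1 -
      Real.log (2 * Real.log (Real.log N) + Real.log 6 - 1))

lemma radInv_summable {b : ℕ} (hb : 2 ≤ b) (n : ℕ) :
    Summable fun i : ℕ => (((n / b ^ i) % b : ℕ) : ℝ) / (b : ℝ) ^ (i + 1) := by
  refine summable_of_ne_finset_zero (s := Finset.range n) fun i hi => ?_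
  have hi' : n ≤ i := by simpa using hi
  have : n / b ^ i = 0 := Nat.div_eq_of_lt (hi'.trans_lt (Nat.lt_pow_self hb))
  simp [this]

lemma radInv_eq {b : ℕ} (hb : 2 ≤ b) (n : ℕ) :
    radInv b n = ((n % b : ℕ) + radInv b (n / b)) / b := by
  have hb0 : (b : ℝ) ≠ 0 := by positivity
  rw [radInv, (radInv_summable hb n).tsum_eq_zero_add, radInv, add_div, ← tsum_div_const]
  congr 1
  · simp
  · congr 1
    ext i
    rw [Nat.div_div_eq_div_mul, ← pow_succ' b i, div_div, ← pow_succ]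

lemma radInv_zero (b : ℕ) : radInv b 0 = 0 := by simp [radInv]

lemma radInv_nonneg (b n : ℕ) : 0 ≤ radInv b n := tsum_nonneg fun _ => by positivity

lemma radInv_lt_one {b : ℕ} (hb : 2 ≤ b) (n : ℕ) : radInv b n < 1 := by
  induction n using Nat.strong_induction_on with
  | _ n ih =>
    rcases Nat.eq_zero_or_pos n with rfl | hn
    · simp [radInv_zero]
    · have h1 := ih (n / b) (Nat.div_lt_self hn hb)
      have h2 : ((n % b : ℕ) : ℝ) + 1 ≤ b := by exact_mod_cast Nat.mod_lt n (by omega)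
      rw [radInv_eq hb, div_lt_one (by positivity)]
      linarith

/-- `f` is the indicator of a residue class modulo a power of `b` (of density `v`), or, once that
power is at least `Q`, a function between zero and such an indicator. -/
def IsPiece (b Q : ℕ) (f : ℕ → ℝ) (v : ℝ) : Prop :=
  ∃ k r : ℕ, ((∀ n, f n = if n ≡ r [MOD b ^ k] then 1 else 0) ∧ v = 1 / (b : ℝ) ^ k) ∨
    ((∀ n, 0 ≤ f n ∧ f n ≤ if n ≡ r [MOD b ^ k] then 1 else 0) ∧
      0 ≤ v ∧ v ≤ 1 / (b : ℝ) ^ k ∧ Q ≤ b ^ k)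

lemma modEq_mul_add_iff {b d : ℕ} (hd : d < b) (q r n : ℕ) :
    n ≡ d + b * r [MOD b * q] ↔ n % b = d ∧ n / b ≡ r [MOD q] := by
  have hb : 0 < b := by omega
  have h1 : (d + b * r) % b = d := by simp [Nat.mod_eq_of_lt hd]
  have h2 : (d + b * r) / b = r := by
    rw [Nat.add_mul_div_left _ _ hb, Nat.div_eq_of_lt hd, zero_add]
  unfold Nat.ModEq
  rw [Nat.mod_mul, Nat.mod_mul, h1, h2]
  constructor
  · intro h
    have h3 : n % b = d := by
      have := congrArg (· % b) h
      simpa [Nat.mod_eq_of_lt hd] using this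
    refine ⟨h3, ?_⟩
    rw [h3] at h
    exact Nat.eq_of_mul_eq_mul_left hb (Nat.add_left_cancel h)
  · rintro ⟨h3, h4⟩
    rw [h3, h4]

lemma IsPiece.lift {b Q : ℕ} {f : ℕ → ℝ} {v : ℝ} (h : IsPiece b Q f v) {d : ℕ} (hd : d < b) :
    IsPiece b (b * Q) (fun n => if n % b = d then f (n / b) else 0) (v / b) := by
  have hb : (0 : ℝ) < b := by exact_mod_cast (by omega : 0 < b)
  obtain ⟨k, r, h⟩ := h
  refine ⟨k + 1, d + b * r, ?_⟩
  simp only [pow_succ', modEq_mul_add_iff hd]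
  have hv : 1 / ((b : ℝ) * b ^ k) = 1 / (b : ℝ) ^ k / b := by rw [div_div, mul_comm]
  rw [hv]
  rcases h with ⟨hf, rfl⟩ | ⟨hf, h0, h1, hQ⟩
  · refine Or.inl ⟨fun n => ?_, rfl⟩
    rw [hf]
    split_ifs <;> simp_all
  · refine Or.inr ⟨fun n => ?_, by positivity, by gcongr, by gcongr⟩
    have := hf (n / b)
    by_cases h3 : n % b = d
    · simpa [h3] using this
    · simp [h3]

/-- An anchored interval splits the radical inverse sequence into few pieces. -/
lemma exists_pieces {b : ℕ} (hb : 2 ≤ b) (m : ℕ) (α : ℝ) (h0 : 0 ≤ α) (h1 : α ≤ 1) :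
    ∃ (M : ℕ) (f : ℕ → ℕ → ℝ) (v : ℕ → ℝ), M ≤ (b - 1) * m + 1 ∧
      (∀ i < M, IsPiece b (b ^ m) (f i) (v i)) ∧
      (∀ n, ∑ i ∈ Finset.range M, f i n = if radInv b n < α then 1 else 0) ∧
      ∑ i ∈ Finset.range M, v i = α := by
  have hb0 : (0 : ℝ) < b := by positivity
  induction m generalizing α with
  | zero =>
    refine ⟨1, fun _ n => if radInv b n < α then 1 else 0, fun _ => α, by simp, ?_, by simp,
      by simp⟩
    intro i _
    refine ⟨0, 0, Or.inr ⟨fun n => ?_, h0, by simpa using h1, by simp⟩⟩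
    simp only [pow_zero, Nat.modEq_one, if_true]
    split_ifs <;> norm_num
  | succ m ih =>
    rcases h1.eq_or_lt with rfl | h1
    · refine ⟨1, fun _ _ => 1, fun _ => 1, by simp, ?_, ?_, by simp⟩
      · intro i _
        exact ⟨0, 0, Or.inl ⟨by simp [Nat.modEq_one], by simp⟩⟩
      · simp [radInv_lt_one hb]
    set d := ⌊b * α⌋₊ with hdd
    have hd1 : (d : ℝ) ≤ b * α := Nat.floor_le (by positivity)
    have hd2 : b * α < d + 1 := Nat.lt_floor_add_one _
    have hdb : d < b := by
      have : (d : ℝ) < b := by nlinarith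
      exact_mod_cast this
    obtain ⟨M, f, v, hM, hp, hs, hv⟩ := ih (b * α - d) (by linarith) (by linarith)
    refine ⟨d + M, fun i n => if i < d then (if n % b = i then 1 else 0) else
      (if n % b = d then f (i - d) (n / b) else 0),
      fun i => if i < d then 1 / b else v (i - d) / b, ?_, ?_, ?_, ?_⟩
    · have : d ≤ b - 1 := by omega
      rw [mul_add]
      omega
    · intro i hi
      by_cases hid : i < d
      · simp only [hid, if_true]
        refine ⟨1, i, Or.inl ⟨fun n => ?_, by simp⟩⟩
        simp [Nat.ModEq, Nat.mod_eq_of_lt (hid.trans hdb)]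
      · simp only [hid, if_false]
        rw [pow_succ']
        exact (hp (i - d) (by omega)).lift hdb
    · intro n
      rw [Finset.sum_range_add]
      have e1 : ∀ i ∈ Finset.range d, (if i < d then (if n % b = i then (1 : ℝ) else 0) else
          (if n % b = d then f (i - d) (n / b) else 0)) = if n % b = i then 1 else 0 := by
        intro i hi
        simp [Finset.mem_range.mp hi]
      rw [Finset.sum_congr rfl e1, Finset.sum_ite_eq]
      simp only [Finset.mem_range, Nat.not_lt.mpr (Nat.le_add_right d _), if_false,
        Nat.add_sub_cancel_left]
      have g0 := radInv_nonneg b (n / b)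
      have g1 := radInv_lt_one hb (n / b)
      simp only [radInv_eq hb n, div_lt_iff₀ hb0, mul_comm α]
      rcases lt_trichotomy (n % b) d with h | h | h
      · have h' : ((n % b : ℕ) : ℝ) + 1 ≤ d := by exact_mod_cast h
        rw [if_pos h, if_pos (by linarith)]
        simp [h.ne]
      · rw [if_neg (by omega)]
        simp only [h, if_true]
        rw [hs]
        simp [lt_sub_iff_add_lt']
      · have h' : (d : ℝ) + 1 ≤ (n % b : ℕ) := by exact_mod_cast h
        rw [if_neg (by omega), if_neg (by linarith)]
        simp [h.ne']
    · rw [Finset.sum_range_add]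
      have e1 : ∀ i ∈ Finset.range d, (if i < d then 1 / (b : ℝ) else v (i - d) / b) = 1 / b := by
        intro i hi
        simp [Finset.mem_range.mp hi]
      rw [Finset.sum_congr rfl e1]
      simp only [Nat.not_lt.mpr (Nat.le_add_right d _), if_false,
        Nat.add_sub_cancel_left, ← Finset.sum_div, hv]
      simp only [Finset.sum_const, Finset.card_range, nsmul_eq_mul]
      field_simp
      ring

lemma sum_modEq_eq {q : ℕ} (hq : 0 < q) (R N : ℕ) :
    ∑ n ∈ Finset.range N, (if n ≡ R [MOD q] then (1 : ℝ) else 0) =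
      (N / q : ℕ) + if R % q < N % q then 1 else 0 := by
  rw [Finset.sum_boole, ← Nat.count_eq_card_filter_range, Nat.count_modEq_card _ hq]
  push_cast
  rfl

lemma abs_sum_modEq_sub_le {q : ℕ} (hq : 0 < q) (R N : ℕ) :
    |∑ n ∈ Finset.range N, (if n ≡ R [MOD q] then (1 : ℝ) else 0) - N * (1 / q)| ≤ 1 := by
  have hq' : (0 : ℝ) < q := by exact_mod_cast hq
  rw [sum_modEq_eq hq, mul_one_div]
  have h1 : ((N / q : ℕ) : ℝ) + (N % q : ℕ) / q = N / q := by
    field_simp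
    exact_mod_cast Nat.div_add_mod' N q
  have h2 : ((N % q : ℕ) : ℝ) / q < 1 := by
    rw [div_lt_one hq']
    exact_mod_cast Nat.mod_lt N hq
  have h3 : (0 : ℝ) ≤ ((N % q : ℕ) : ℝ) / q := by positivity
  rw [abs_le]
  by_cases h : R % q < N % q
  · rw [if_pos h]
    constructor <;> linarith
  · rw [if_neg h]
    constructor <;> linarith

lemma sum_modEq_le_one {q : ℕ} (hq : 0 < q) (R : ℕ) {N : ℕ} (h : N ≤ q) :
    ∑ n ∈ Finset.range N, (if n ≡ R [MOD q] then (1 : ℝ) else 0) ≤ 1 := by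
  rw [sum_modEq_eq hq]
  rcases h.eq_or_lt with rfl | h
  · simp [Nat.div_self hq]
  · rw [Nat.div_eq_of_lt h]
    split_ifs <;> norm_num

lemma modEq_prod_univ_iff {ι : Type} [Fintype ι] {q : ι → ℕ}
    (hq : Pairwise fun i j => Nat.Coprime (q i) (q j)) (a c : ℕ) :
    a ≡ c [MOD ∏ i, q i] ↔ ∀ i, a ≡ c [MOD q i] := by
  have h := Nat.modEq_list_map_prod_iff (a := a) (b := c) (s := q) (l := (Finset.univ : Finset ι).toList)
    ((Finset.nodup_toList _).pairwise_of_forall_ne fun i _ j _ hij => hq hij)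
  simpa [Finset.prod_map_toList] using h

lemma abs_sum_prod_pieces_sub_le {ι : Type} [Fintype ι] {b Q : ι → ℕ} (hb : ∀ i, 2 ≤ b i)
    (hcop : Pairwise fun i j => Nat.Coprime (b i) (b j)) {N : ℕ} (hQ : ∀ i, N ≤ Q i)
    {f : ι → ℕ → ℝ} {v : ι → ℝ} (h : ∀ i, IsPiece (b i) (Q i) (f i) (v i)) :
    |∑ n ∈ Finset.range N, ∏ i, f i n - N * ∏ i, v i| ≤ 1 := by
  classical
  choose k r hkr using h
  set q : ι → ℕ := fun i => b i ^ k i with hqdef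
  have hqpos : ∀ i, 0 < q i := fun i => pow_pos (by have := hb i; omega) _
  have hqcop : Pairwise fun i j => Nat.Coprime (q i) (q j) :=
    fun i j hij => Nat.Coprime.pow _ _ (hcop hij)
  obtain ⟨R, hR⟩ := Nat.chineseRemainderOfFinset r q Finset.univ (fun i _ => (hqpos i).ne')
    (fun i _ j _ hij => hqcop hij)
  have hprodpos : 0 < ∏ i, q i := Finset.prod_pos fun i _ => hqpos i
  have hiff : ∀ n, n ≡ R [MOD ∏ i, q i] ↔ ∀ i, n ≡ r i [MOD q i] := fun n => by
    rw [modEq_prod_univ_iff hqcop]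
    exact forall_congr' fun i =>
      ⟨fun h => h.trans (hR i (Finset.mem_univ _)), fun h => h.trans (hR i (Finset.mem_univ _)).symm⟩
  have hind : ∀ n, ∏ i, (if n ≡ r i [MOD q i] then (1 : ℝ) else 0) =
      if n ≡ R [MOD ∏ i, q i] then 1 else 0 := fun n => by
    rw [Finset.prod_boole]
    simp [hiff]
  have hvol : ∏ i, 1 / (b i : ℝ) ^ k i = 1 / ((∏ i, q i : ℕ) : ℝ) := by
    rw [Finset.prod_div_distrib]
    simp [hqdef]
  by_cases hall : ∀ i, (∀ n, f i n = if n ≡ r i [MOD q i] then 1 else 0) ∧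
      v i = 1 / (b i : ℝ) ^ k i
  · have e : ∀ n, ∏ i, f i n = if n ≡ R [MOD ∏ i, q i] then 1 else 0 := fun n => by
      rw [← hind]
      exact Finset.prod_congr rfl fun i _ => (hall i).1 n
    rw [Finset.prod_congr rfl fun i _ => (hall i).2, hvol, Finset.sum_congr rfl fun n _ => e n]
    exact abs_sum_modEq_sub_le hprodpos R N
  · push Not at hall
    obtain ⟨i₀, hi₀⟩ := hall
    have hNq : N ≤ ∏ i, q i := by
      rcases hkr i₀ with h | h
      · exact absurd h.2 (hi₀ h.1)
      · exact ((hQ i₀).trans h.2.2.2).trans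
          (Nat.le_of_dvd hprodpos (Finset.dvd_prod_of_mem q (Finset.mem_univ i₀)))
    have hf : ∀ i n, 0 ≤ f i n ∧ f i n ≤ if n ≡ r i [MOD q i] then 1 else 0 := fun i n => by
      rcases hkr i with h | h
      · rw [h.1 n]
        exact ⟨by split_ifs <;> norm_num, le_rfl⟩
      · exact h.1 n
    have hv : ∀ i, 0 ≤ v i ∧ v i ≤ 1 / (b i : ℝ) ^ k i := fun i => by
      rcases hkr i with h | h
      · rw [h.2]
        exact ⟨by positivity, le_rfl⟩
      · exact ⟨h.2.1, h.2.2.1⟩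
    have s0 : 0 ≤ ∑ n ∈ Finset.range N, ∏ i, f i n :=
      Finset.sum_nonneg fun n _ => Finset.prod_nonneg fun i _ => (hf i n).1
    have s1 : ∑ n ∈ Finset.range N, ∏ i, f i n ≤ 1 := by
      refine le_trans (Finset.sum_le_sum fun n _ => ?_) (sum_modEq_le_one hprodpos R hNq)
      rw [← hind]
      exact Finset.prod_le_prod (fun i _ => (hf i n).1) fun i _ => (hf i n).2
    have v0 : 0 ≤ N * ∏ i, v i :=
      mul_nonneg (Nat.cast_nonneg _) (Finset.prod_nonneg fun i _ => (hv i).1)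
    have v1 : N * ∏ i, v i ≤ 1 := by
      have : ∏ i, v i ≤ 1 / ((∏ i, q i : ℕ) : ℝ) := by
        rw [← hvol]
        exact Finset.prod_le_prod (fun i _ => (hv i).1) fun i _ => (hv i).2
      calc (N : ℝ) * ∏ i, v i ≤ N * (1 / ((∏ i, q i : ℕ) : ℝ)) := by gcongr
        _ ≤ 1 := by
          rw [mul_one_div, div_le_one (by exact_mod_cast hprodpos)]
          exact_mod_cast hNq
    rw [abs_le]
    constructor <;> linarith

lemma starDisc_le_of_forall {ι : Type} [Fintype ι] {N : ℕ} {P : Fin N → ι → ℝ} {C : ℝ}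
    (hP : ∀ n i, 0 ≤ P n i)
    (h : ∀ α : ι → ℝ, (∀ i, 0 ≤ α i ∧ α i ≤ 1) →
      |(∑ n : Fin N, ∏ i, if P n i < α i then (1 : ℝ) else 0) / N - ∏ i, α i| ≤ C) :
    starDisc N P ≤ C := by
  classical
  refine csSup_le ⟨_, 0, by simp, rfl⟩ ?_
  rintro t ⟨α, hα, rfl⟩
  refine le_of_eq_of_le ?_ (h α hα)
  simp [hP, Finset.prod_boole]

lemma starDisc_le_one {ι : Type} [Fintype ι] {N : ℕ} {P : Fin N → ι → ℝ}
    (hP : ∀ n i, 0 ≤ P n i) : starDisc N P ≤ 1 := by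
  refine starDisc_le_of_forall hP fun α hα => ?_
  have a0 : 0 ≤ ∏ i, α i := Finset.prod_nonneg fun i _ => (hα i).1
  have a1 : ∏ i, α i ≤ 1 := Finset.prod_le_one (fun i _ => (hα i).1) fun i _ => (hα i).2
  have c0 : ∀ n : Fin N, 0 ≤ ∏ i, if P n i < α i then (1 : ℝ) else 0 :=
    fun n => Finset.prod_nonneg fun i _ => by split_ifs <;> norm_num
  have c1 : ∀ n : Fin N, (∏ i, if P n i < α i then (1 : ℝ) else 0) ≤ 1 :=
    fun n => Finset.prod_le_one (fun i _ => by split_ifs <;> norm_num)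
      fun i _ => by split_ifs <;> norm_num
  have s0 : 0 ≤ (∑ n : Fin N, ∏ i, if P n i < α i then (1 : ℝ) else 0) / N :=
    div_nonneg (Finset.sum_nonneg fun n _ => c0 n) (Nat.cast_nonneg _)
  have s1 : (∑ n : Fin N, ∏ i, if P n i < α i then (1 : ℝ) else 0) / N ≤ 1 := by
    refine div_le_one_of_le₀ ?_ (Nat.cast_nonneg _)
    simpa using Finset.sum_le_sum fun (n : Fin N) (_ : n ∈ Finset.univ) => c1 n
  rw [abs_le]
  constructor <;> linarith

/-- Star discrepancy bound for radical inverse sequences in pairwise coprime bases. -/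
lemma starDisc_radInv_le {ι : Type} [Fintype ι] {b m : ι → ℕ} (hb : ∀ i, 2 ≤ b i)
    (hcop : Pairwise fun i j => Nat.Coprime (b i) (b j)) {N : ℕ} (hN : 0 < N)
    (hm : ∀ i, N ≤ b i ^ m i) :
    starDisc N (fun (n : Fin N) i => radInv (b i) n) ≤
      (∏ i, (((b i - 1) * m i + 1 : ℕ) : ℝ)) / N := by
  classical
  have hN' : (0 : ℝ) < N := by exact_mod_cast hN
  refine starDisc_le_of_forall (fun n i => radInv_nonneg _ _) fun α hα => ?_
  choose M f v hM hp hs hv using fun i => exists_pieces (hb i) (m i) (α i) (hα i).1 (hα i).2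
  rw [Fin.sum_univ_eq_sum_range (fun n => ∏ i, if radInv (b i) n < α i then (1 : ℝ) else 0)]
  set T := Fintype.piFinset fun i => Finset.range (M i) with hT
  have e1 : ∑ n ∈ Finset.range N, ∏ i, (if radInv (b i) n < α i then (1 : ℝ) else 0) =
      ∑ τ ∈ T, ∑ n ∈ Finset.range N, ∏ i, f i (τ i) n := by
    rw [Finset.sum_comm]
    refine Finset.sum_congr rfl fun n _ => ?_
    rw [hT, ← Finset.prod_univ_sum (fun i => Finset.range (M i)) fun i t => f i t n]
    exact Finset.prod_congr rfl fun i _ => (hs i n).symm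
  have e2 : ∏ i, α i = ∑ τ ∈ T, ∏ i, v i (τ i) := by
    rw [hT, ← Finset.prod_univ_sum]
    exact Finset.prod_congr rfl fun i _ => (hv i).symm
  have key : |∑ n ∈ Finset.range N, ∏ i, (if radInv (b i) n < α i then (1 : ℝ) else 0) -
      N * ∏ i, α i| ≤ ∏ i, (((b i - 1) * m i + 1 : ℕ) : ℝ) := by
    rw [e1, e2, Finset.mul_sum, ← Finset.sum_sub_distrib]
    calc _ ≤ ∑ τ ∈ T, |∑ n ∈ Finset.range N, ∏ i, f i (τ i) n - N * ∏ i, v i (τ i)| :=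
          Finset.abs_sum_le_sum_abs _ _
      _ ≤ ∑ τ ∈ T, (1 : ℝ) := by
          refine Finset.sum_le_sum fun τ hτ => ?_
          refine abs_sum_prod_pieces_sub_le hb hcop hm fun i => hp i (τ i) ?_
          exact Finset.mem_range.mp (Fintype.mem_piFinset.mp hτ i)
      _ = ∏ i, (M i : ℝ) := by simp [hT, Fintype.card_piFinset]
      _ ≤ _ := Finset.prod_le_prod (fun i _ => by positivity) fun i _ => by exact_mod_cast hM i
  rw [div_sub' hN'.ne', abs_div, abs_of_pos hN']
  gcongr

lemma nth_prime_le (j : ℕ) :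
    (Nat.nth Nat.Prime j : ℝ) ≤ 3 * (j + 1) * Real.log (Nat.nth Nat.Prime j) := by
  set p := Nat.nth Nat.Prime j with hp
  have h2 : 2 ≤ p := (Nat.prime_nth_prime j).two_le
  have hpi : Nat.primeCounting (p - 1) = j := by
    rw [← Nat.primeCounting'_nth_eq j, ← hp, Nat.primeCounting, Nat.sub_add_cancel (by omega)]
  have h := (Chebyshev.psi_ge (p - 1)).trans (Chebyshev.psi_le_primeCounting_mul_log (p - 1))
  rw [hpi, Nat.cast_sub (by omega)] at h
  have h2' : (2 : ℝ) ≤ p := by exact_mod_cast h2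
  have h3 : Real.log ((p : ℝ) - 1) ≤ Real.log p := Real.log_le_log (by linarith) (by linarith)
  have h4 : (j : ℝ) * Real.log ((p : ℝ) - 1) ≤ j * Real.log p := by gcongr
  have h5 := Real.log_two_gt_d9
  simp only [Nat.cast_one, sub_add_cancel] at h
  nlinarith

lemma card_factorial_le_prod {d : ℕ} (u : Finset (Fin d)) :
    (u.card).factorial ≤ ∏ j ∈ u, (j.1 + 1) := by
  induction u using Finset.induction_on_max with
  | empty => simp
  | insert a s hs ih =>
    have ha : a ∉ s := fun h => lt_irrefl _ (hs a h)
    have hc : s.card ≤ a.1 := by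
      have := Finset.card_le_card (fun x hx => Finset.mem_Iio.mpr (hs x hx) : s ⊆ Finset.Iio a)
      simpa using this
    rw [Finset.card_insert_of_notMem ha, Finset.prod_insert ha, Nat.factorial_succ]
    gcongr

lemma pieces_nth_prime_le {N j : ℕ} (hN : 12 ≤ Real.log N) (hj : j + 1 ≤ N) :
    (((Nat.nth Nat.Prime j - 1) * Nat.clog (Nat.nth Nat.Prime j) N + 1 : ℕ) : ℝ) ≤
      6 * Real.log N * (j + 1) := by
  have hN1 : 1 < N := by
    by_contra hN1
    have : N = 0 ∨ N = 1 := by omega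
    rcases this with rfl | rfl <;> norm_num at hN
  have hNpos : (0 : ℝ) < N := by exact_mod_cast (by omega : 0 < N)
  have hp := nth_prime_le j
  set p := Nat.nth Nat.Prime j with hpdef
  have h2 : 2 ≤ p := (Nat.prime_nth_prime j).two_le
  have h2' : (2 : ℝ) ≤ p := by exact_mod_cast h2
  have hlp : 0 < Real.log p := Real.log_pos (by linarith)
  set m := Nat.clog p N with hm
  have hm1 : 0 < m := Nat.clog_pos (by omega) (by omega)
  have step : (((p - 1) * m + 1 : ℕ) : ℝ) ≤ p * m := by
    have : (p - 1) * m + 1 ≤ p * m := by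
      obtain ⟨c, hc⟩ := Nat.exists_eq_add_of_le' (show 1 ≤ p by omega)
      rw [hc, Nat.add_sub_cancel, add_mul]
      omega
    exact_mod_cast this
  refine step.trans ?_
  rcases lt_or_ge p N with hpN | hpN
  · have hlog : Real.log p ≤ Real.log N := Real.log_le_log (by linarith) (by exact_mod_cast hpN.le)
    have hpow : p ^ (m - 1) < N := Nat.pow_pred_clog_lt_self (by omega) (by omega)
    have hmlog : ((m : ℝ) - 1) * Real.log p ≤ Real.log N := by
      have : Real.log ((p : ℝ) ^ (m - 1)) ≤ Real.log N :=
        Real.log_le_log (by positivity) (by exact_mod_cast hpow.le)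
      rw [Real.log_pow, Nat.cast_sub hm1] at this
      simpa using this
    have : (m : ℝ) * Real.log p ≤ 2 * Real.log N := by linarith
    calc (p : ℝ) * m ≤ 3 * (j + 1) * Real.log p * m := by gcongr
      _ = 3 * (j + 1) * (m * Real.log p) := by ring
      _ ≤ 3 * (j + 1) * (2 * Real.log N) := by gcongr
      _ = _ := by ring
  · have hm' : m ≤ 1 := (Nat.clog_le_iff_le_pow (by omega)).mpr (by simpa using hpN)
    have hme : m = 1 := by omega
    rw [hme, Nat.cast_one, mul_one]
    have hlog2 : Real.log p ≤ 2 * Real.log N := by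
      have hjN : Real.log (j + 1) ≤ Real.log N :=
        Real.log_le_log (by positivity) (by exact_mod_cast hj)
      have hlpN : 12 ≤ Real.log p :=
        hN.trans (Real.log_le_log hNpos (by exact_mod_cast hpN))
      have e1 : Real.log p ≤ Real.log 3 + Real.log (j + 1) + Real.log (Real.log p) := by
        have := Real.log_le_log (by linarith) hp
        rwa [Real.log_mul (by positivity) hlp.ne', Real.log_mul (by norm_num) (by positivity)]
          at this
      have e2 : Real.log (Real.log p) ≤ Real.log p / 6 - 1 + Real.log 6 := by
        have := Real.log_le_sub_one_of_pos (show 0 < Real.log p / 6 by positivity)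
        rw [Real.log_div hlp.ne' (by norm_num)] at this
        linarith
      have e3 : Real.log 3 + Real.log 6 ≤ 5 := by
        have a := Real.log_le_sub_one_of_pos (show (0 : ℝ) < 3 by norm_num)
        have b : Real.log 6 = Real.log 2 + Real.log 3 := by
          rw [← Real.log_mul (by norm_num) (by norm_num)]; norm_num
        have c := Real.log_two_lt_d9
        linarith
      linarith
    calc (p : ℝ) ≤ 3 * (j + 1) * Real.log p := hp
      _ ≤ 3 * (j + 1) * (2 * Real.log N) := by gcongr
      _ = _ := by ring

lemma haltonProjStarDisc_le_one (d N : ℕ) (u : Finset (Fin d)) : haltonProjStarDisc d N u ≤ 1 :=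
  starDisc_le_one fun _ _ => radInv_nonneg _ _

lemma haltonProjStarDisc_le {d N : ℕ} {u : Finset (Fin d)} (hN : 12 ≤ Real.log N)
    (hu : ∀ j ∈ u, j.1 + 1 ≤ N) :
    haltonProjStarDisc d N u ≤ (6 * Real.log N) ^ u.card * (∏ j ∈ u, ((j.1 : ℝ) + 1)) / N := by
  have hNpos : 0 < N := by
    rcases Nat.eq_zero_or_pos N with rfl | h
    · norm_num at hN
    · exact h
  have hpr : ∀ j, (Nat.nth Nat.Prime j).Prime := Nat.prime_nth_prime
  have h := starDisc_radInv_le (ι := u) (N := N) (b := fun i => Nat.nth Nat.Prime i.1.1)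
    (m := fun i => Nat.clog (Nat.nth Nat.Prime i.1.1) N) (fun i => (hpr _).two_le)
    (fun i j hij => (Nat.coprime_primes (hpr _) (hpr _)).mpr fun h => hij <| Subtype.ext <|
      Fin.ext <| Nat.nth_injective Nat.infinite_setOfPred_prime h)
    hNpos (fun i => Nat.le_pow_clog (hpr _).one_lt _)
  refine h.trans ?_
  gcongr
  rw [← Finset.prod_const, ← Finset.prod_mul_distrib, ← Finset.prod_coe_sort u]
  exact Finset.prod_le_prod (fun i _ => by positivity)
    fun i _ => pieces_nth_prime_le hN (hu i.1 i.2)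

lemma le_log_factorial {s : ℕ} (hs : 0 < s) :
    (s : ℝ) * (Real.log s - 1) ≤ Real.log s.factorial := by
  have hs' : (0 : ℝ) < s := by exact_mod_cast hs
  have h := Real.pow_div_factorial_le_exp (x := (s : ℝ)) hs'.le s
  have := Real.log_le_log (by positivity) h
  rw [Real.log_exp, Real.log_div (by positivity) (by positivity), Real.log_pow] at this
  linarith

lemma log_six_log_twelve_bounds : 1.73 < Real.log 6 ∧ 2.42 < Real.log 12 := by
  have h2 := Real.log_two_gt_d9
  have h3 : 3 * Real.log 2 ≤ 2 * Real.log 3 := by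
    have h : Real.log ((2 : ℝ) ^ 3) ≤ Real.log ((3 : ℝ) ^ 2) :=
      Real.log_le_log (by norm_num) (by norm_num)
    simpa [Real.log_pow] using h
  have h6 : Real.log 6 = Real.log 2 + Real.log 3 := by
    rw [← Real.log_mul (by norm_num) (by norm_num)]; norm_num
  have h12 : Real.log 12 = Real.log 2 + Real.log 6 := by
    rw [← Real.log_mul (by norm_num) (by norm_num)]; norm_num
  constructor <;> linarith

lemma twelve_le_of_log {L : ℝ} (hL : 1 < L)
    (h : 0 < Real.log L - 1 - Real.log (2 * Real.log L + Real.log 6 - 1)) : 12 ≤ L := by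
  obtain ⟨h6, h12⟩ := log_six_log_twelve_bounds
  have hl : 0 < Real.log L := Real.log_pos hL
  by_contra! hL12
  have hA : 0 < 2 * Real.log L + Real.log 6 - 1 := by linarith
  have hAL : (2 * Real.log L + Real.log 6 - 1) * Real.exp 1 < L := by
    rw [← Real.log_lt_log_iff (by positivity) (by linarith),
      Real.log_mul hA.ne' (Real.exp_pos 1).ne', Real.log_exp]
    linarith
  have hchord : (L - 1) / 11 * Real.log 12 ≤ Real.log L := by
    have := strictConcaveOn_log_Ioi.concaveOn.2 (Set.mem_Ioi.mpr (zero_lt_one' ℝ))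
      (Set.mem_Ioi.mpr (show (0 : ℝ) < 12 by norm_num))
      (show 0 ≤ 1 - (L - 1) / 11 by linarith) (show 0 ≤ (L - 1) / 11 by linarith) (by ring)
    simp only [Real.log_one, smul_eq_mul, mul_zero, zero_add] at this
    refine this.trans (le_of_eq ?_)
    congr 1
    ring
  have he := Real.exp_one_gt_d9
  nlinarith

lemma haltonProjStarDisc_le_rpow {d N : ℕ} (hN : 4 ≤ N) (u : Finset (Fin d)) :
    haltonProjStarDisc d N u ≤
      (N : ℝ) ^ (-(1 - deltaStar N)) * ∏ j ∈ u, ((j.1 : ℝ) + 1) := by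
  obtain ⟨h6, -⟩ := log_six_log_twelve_bounds
  have hN4 : (4 : ℝ) ≤ N := by exact_mod_cast hN
  have hNpos : (0 : ℝ) < N := by linarith
  have hL1 : 1 < Real.log N := by
    rw [Real.lt_log_iff_exp_lt hNpos]
    linarith [Real.exp_one_lt_d9]
  have hPi1 : 1 ≤ ∏ j ∈ u, ((j.1 : ℝ) + 1) := by
    exact_mod_cast Finset.one_le_prod' (s := u) (f := fun j : Fin d => j.1 + 1) fun j _ => by omega
  have hone := haltonProjStarDisc_le_one d N u
  rw [Real.rpow_def_of_pos hNpos]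
  set P := ∏ j ∈ u, ((j.1 : ℝ) + 1) with hP
  set L := Real.log N with hLdef
  have hl : 0 < Real.log L := Real.log_pos hL1
  set A := 2 * Real.log L + Real.log 6 - 1 with hAdef
  have hA : 0 < A := by linarith
  have hD : 0 < A - Real.log A := by linarith [Real.log_le_sub_one_of_pos hA]
  have hδ : deltaStar N = (Real.log L + Real.log 6) / (A - Real.log A) := rfl
  have hδ0 : 0 ≤ deltaStar N := by rw [hδ]; exact div_nonneg (by linarith) hD.le
  have hδ1 : 1 - deltaStar N = (Real.log L - 1 - Real.log A) / (A - Real.log A) := by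
    rw [hδ, eq_div_iff hD.ne', sub_mul, div_mul_cancel₀ _ hD.ne']
    ring
  rcases le_or_gt (Real.log L - 1 - Real.log A) 0 with hG | hG
  · have : 1 - deltaStar N ≤ 0 := by
      rw [hδ1]
      exact div_nonpos_of_nonpos_of_nonneg hG hD.le
    refine hone.trans (one_le_mul_of_one_le_of_one_le (Real.one_le_exp ?_) hPi1)
    nlinarith
  have hL12 : 12 ≤ L := twelve_le_of_log hL1 hG
  by_cases hlarge : ∃ j ∈ u, N < j.1 + 1
  · obtain ⟨j, hj, hjN⟩ := hlarge
    have hNP : (N : ℝ) ≤ P := by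
      have h1 : j.1 + 1 ≤ ∏ j ∈ u, (j.1 + 1) :=
        Finset.single_le_prod' (f := fun j : Fin d => j.1 + 1) (fun i _ => by omega) hj
      rw [hP]
      exact_mod_cast hjN.le.trans h1
    refine hone.trans ?_
    calc (1 : ℝ) = Real.exp (-L) * N := by
          rw [Real.exp_neg, hLdef, Real.exp_log hNpos, inv_mul_cancel₀ hNpos.ne']
      _ ≤ Real.exp (L * -(1 - deltaStar N)) * P := by
          gcongr
          nlinarith
  push Not at hlarge
  rcases le_or_gt (L / (A - Real.log A)) u.card with hs | hs
  · have hl1 : 1 ≤ Real.log L := by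
      rw [Real.le_log_iff_exp_le (by linarith)]
      linarith [Real.exp_one_lt_d9]
    have hlogA : 0 ≤ Real.log A := Real.log_nonneg (by linarith)
    have hLD : 0 < L / (A - Real.log A) := by positivity
    have hspos : (0 : ℝ) < u.card := hLD.trans_le hs
    have hlogs : Real.log L - Real.log A ≤ Real.log u.card := by
      rw [← Real.log_div (by linarith) hA.ne']
      refine Real.log_le_log (by positivity) (le_trans ?_ hs)
      gcongr
      linarith
    have hfac : ((u.card.factorial : ℕ) : ℝ) ≤ P := by
      rw [hP]
      exact_mod_cast card_factorial_le_prod u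
    have hlogP : L * (1 - deltaStar N) ≤ Real.log P := by
      calc L * (1 - deltaStar N) = L / (A - Real.log A) * (Real.log L - 1 - Real.log A) := by
            rw [hδ1]; ring
        _ ≤ u.card * (Real.log u.card - 1) := by
            apply mul_le_mul hs (by linarith) hG.le hspos.le
        _ ≤ Real.log u.card.factorial := le_log_factorial (by exact_mod_cast hspos)
        _ ≤ Real.log P := Real.log_le_log (by positivity) hfac
    refine hone.trans ?_
    rw [← Real.exp_log (show 0 < P by linarith), ← Real.exp_add]
    exact Real.one_le_exp (by linarith)
  · refine (haltonProjStarDisc_le hL12 hlarge).trans ?_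
    have h6L : (6 * L) ^ u.card = Real.exp (u.card * (Real.log L + Real.log 6)) := by
      rw [Real.exp_nat_mul, Real.exp_add, Real.exp_log (by linarith), Real.exp_log (by norm_num),
        mul_comm L]
    rw [h6L, mul_div_right_comm]
    gcongr
    have hNexp : (N : ℝ) = Real.exp L := (Real.exp_log hNpos).symm
    rw [hNexp, ← Real.exp_sub, Real.exp_le_exp]
    have : (u.card : ℝ) * (Real.log L + Real.log 6) ≤ L * deltaStar N := by
      calc (u.card : ℝ) * (Real.log L + Real.log 6)
          ≤ L / (A - Real.log A) * (Real.log L + Real.log 6) := by gcongr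
        _ = _ := by rw [hδ]; ring
    linarith

/-- `D*_{N,γ}(H_{d,N}) ≤ N^{−(1−δ*(N))} · max_{∅≠u⊆[d]} ∏_{j∈u} (j·γ_j)` for `N ≥ 4`. -/
theorem halton_weighted_star_disc_deltaStar_bound
    (γ : ℕ → ℝ) (hpos : ∀ j : ℕ, 1 ≤ j → 0 < γ j)
    (hmono : ∀ j : ℕ, 1 ≤ j → γ (j + 1) ≤ γ j) :
    ∀ d : ℕ, 1 ≤ d → ∀ N : ℕ, 4 ≤ N →
      wHaltonStarDisc γ d N ≤
        (N : ℝ) ^ (-(1 - deltaStar N)) *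
          sSup {t : ℝ | ∃ u : Finset (Fin d), u.Nonempty ∧
            t = ∏ j ∈ u, (((j.1 + 1 : ℕ) : ℝ) * γ (j.1 + 1))} := by
  intro d hd N hN
  have hfin : {t : ℝ | ∃ u : Finset (Fin d), u.Nonempty ∧
      t = ∏ j ∈ u, (((j.1 + 1 : ℕ) : ℝ) * γ (j.1 + 1))}.Finite := by
    refine (Set.finite_range fun u : Finset (Fin d) =>
      ∏ j ∈ u, (((j.1 + 1 : ℕ) : ℝ) * γ (j.1 + 1))).subset ?_
    rintro t ⟨u, -, rfl⟩
    exact ⟨u, rfl⟩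
  refine csSup_le ⟨_, {⟨0, hd⟩}, by simp, rfl⟩ ?_
  rintro t ⟨u, hu, rfl⟩
  have hγ : 0 ≤ ∏ j ∈ u, γ (j.1 + 1) := Finset.prod_nonneg fun j _ => (hpos _ (by omega)).le
  calc (∏ j ∈ u, γ (j.1 + 1)) * haltonProjStarDisc d N u
      ≤ (∏ j ∈ u, γ (j.1 + 1)) *
          ((N : ℝ) ^ (-(1 - deltaStar N)) * ∏ j ∈ u, ((j.1 : ℝ) + 1)) := by
        gcongr
        exact haltonProjStarDisc_le_rpow hN u
    _ = (N : ℝ) ^ (-(1 - deltaStar N)) *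
          ∏ j ∈ u, (((j.1 + 1 : ℕ) : ℝ) * γ (j.1 + 1)) := by
        rw [Finset.prod_mul_distrib]
        push_cast
        ring
    _ ≤ _ := by
        gcongr
        exact le_csSup hfin.bddAbove ⟨u, hu, rfl⟩
end
end

section
/- Let γ_1 ≥ γ_2 ≥ ⋯ be a nonincreasing sequence of positive reals defining product weights γ_u = ∏_{j∈u} γ_j, and suppose ∑_{j≥1} j·γ_j < ∞. Then for every δ ∈ (0,1) there exists a constant c_δ > 0 such that for all dimensions d ≥ 1 and all integers N ≥ 2, the weighted unanchored discrepancy of the first N points of the d-dimensional Halton sequence satisfies D_{N,γ}(H_{d,N}) = max_{∅≠u⊆{1,…,d}} γ_u · D_N(H_{d,N}(u)) ≤ c_δ / N^{1−δ}. -/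
open Finset Real

noncomputable section

open scoped Classical in
/-- Unanchored discrepancy of the point set `P` of `N` points:
`D_N(P) = sup_{0 ≤ a ≤ b ≤ 1} |#{n : P n ∈ [a,b)}/N − ∏ᵢ (bᵢ − aᵢ)|`. -/
def unanchoredDisc {ι : Type} [Fintype ι] (N : ℕ) (P : Fin N → ι → ℝ) : ℝ :=
  sSup {t : ℝ | ∃ a b : ι → ℝ, (∀ i, 0 ≤ a i ∧ a i ≤ b i ∧ b i ≤ 1) ∧
    t = |((Finset.univ.filter fun n : Fin N => ∀ i, a i ≤ P n i ∧ P n i < b i).card : ℝ) / N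
          - ∏ i, (b i - a i)|}

/-- Unanchored discrepancy of the projection of the first `N` points of the
`d`-dimensional Halton sequence onto the coordinates in `u`. -/
def haltonProjUnanchDisc (d N : ℕ) (u : Finset (Fin d)) : ℝ :=
  unanchoredDisc N fun n (i : u) => halton d n i.1

/-- Weighted unanchored discrepancy of the first `N` points of the `d`-dimensional
Halton sequence with product weights `γ` (1-based). -/
def wHaltonUnanchDisc (γ : ℕ → ℝ) (d N : ℕ) : ℝ :=
  sSup {t : ℝ | ∃ u : Finset (Fin d), u.Nonempty ∧
    t = (∏ j ∈ u, γ (j.1 + 1)) * haltonProjUnanchDisc d N u}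

/-- `ResidueComb p f C v` says that `f` is a signed sum of at most `C` indicators of residue
classes modulo powers of `p`, of total (signed) density `v`. -/
inductive ResidueComb (p : ℕ) : (ℕ → ℝ) → ℕ → ℝ → Prop
  | zero : ResidueComb p (fun _ => 0) 0 0
  | atom (k r : ℕ) :
      ResidueComb p (fun n => if n ≡ r [MOD p ^ k] then 1 else 0) 1 (1 / (p : ℝ) ^ k)
  | add {f g : ℕ → ℝ} {C D : ℕ} {v w : ℝ} (hf : ResidueComb p f C v)
      (hg : ResidueComb p g D w) : ResidueComb p (fun n => f n + g n) (C + D) (v + w)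
  | sub {f g : ℕ → ℝ} {C D : ℕ} {v w : ℝ} (hf : ResidueComb p f C v)
      (hg : ResidueComb p g D w) : ResidueComb p (fun n => f n - g n) (C + D) (v - w)

theorem abs_count_modEq_sub_le_one (N m r : ℕ) (hm : 0 < m) :
    |(∑ n ∈ range N, if n ≡ r [MOD m] then (1 : ℝ) else 0) - N / m| ≤ 1 := by
  have hm' : (0 : ℝ) < m := by exact_mod_cast hm
  have h := Nat.count_modEq_card N hm r
  rw [Finset.sum_boole, ← Nat.count_eq_card_filter_range, h]
  have hdiv : (N : ℝ) / m = (N / m : ℕ) + ((N % m : ℕ) : ℝ) / m := by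
    have : (N : ℝ) = m * (N / m : ℕ) + (N % m : ℕ) := by exact_mod_cast (Nat.div_add_mod N m).symm
    rw [eq_comm, ← sub_eq_zero]
    field_simp
    linarith
  have h0 : 0 ≤ ((N % m : ℕ) : ℝ) / m := by positivity
  have h1 : ((N % m : ℕ) : ℝ) / m ≤ 1 := by
    rw [div_le_one hm']
    exact_mod_cast (Nat.mod_lt N hm).le
  rw [hdiv, abs_le]
  split_ifs <;> constructor <;> push_cast <;> linarith

/-- Equidistribution, up to an error given by the product of the number of terms, of products of
residue class combinations for pairwise coprime bases along an arithmetic progression. -/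
theorem ResidueComb.abs_sum_prod_sub_le {ι : Type} {p : ι → ℕ}
    (hp : ∀ i, 0 < p i) (hcop : Pairwise fun i j => (p i).Coprime (p j))
    {f : ι → ℕ → ℝ} {C : ι → ℕ} {v : ι → ℝ} (hf : ∀ i, ResidueComb (p i) (f i) (C i) (v i))
    (N : ℕ) (s : Finset ι) :
    ∀ m r : ℕ, 0 < m → (∀ i ∈ s, m.Coprime (p i)) →
      |(∑ n ∈ range N, (if n ≡ r [MOD m] then (1 : ℝ) else 0) * ∏ i ∈ s, f i n)
        - N / m * ∏ i ∈ s, v i| ≤ ∏ i ∈ s, (C i : ℝ) := by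
  classical
  induction s using Finset.induction_on with
  | empty =>
    intro m r hm _
    simpa using abs_count_modEq_sub_le_one N m r hm
  | insert a s ha ih =>
    intro m r hm hms
    simp only [Finset.prod_insert ha]
    have hCs : 0 ≤ ∏ i ∈ s, (C i : ℝ) := by positivity
    generalize f a = g, C a = c, v a = w, hf a = hg
    induction hg with
    | zero => simp
    | atom k r' =>
      have hcm : m.Coprime (p a ^ k) := (hms a (mem_insert_self a s)).pow_right k
      obtain ⟨r'', h1, h2⟩ := Nat.chineseRemainder hcm r r'
      have key : ∀ n, (if n ≡ r'' [MOD m * p a ^ k] then (1 : ℝ) else 0) =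
          (if n ≡ r [MOD m] then (1 : ℝ) else 0) *
            (if n ≡ r' [MOD p a ^ k] then (1 : ℝ) else 0) := by
        intro n
        have : n ≡ r'' [MOD m * p a ^ k] ↔ n ≡ r [MOD m] ∧ n ≡ r' [MOD p a ^ k] := by
          rw [← Nat.modEq_and_modEq_iff_modEq_mul hcm]
          exact ⟨fun h => ⟨h.1.trans h1, h.2.trans h2⟩,
            fun h => ⟨h.1.trans h1.symm, h.2.trans h2.symm⟩⟩
        by_cases hA : n ≡ r [MOD m] <;> by_cases hB : n ≡ r' [MOD p a ^ k] <;>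
          simp [this, hA, hB]
      have := ih (m * p a ^ k) r'' (Nat.mul_pos hm (pow_pos (hp a) k)) (fun i hi =>
        Nat.Coprime.mul_left (hms i (mem_insert_of_mem hi))
          ((hcop (ne_of_mem_of_not_mem hi ha).symm).pow_left k))
      simp only [key] at this
      push_cast at this ⊢
      rw [one_mul]
      convert this using 2
      congr 1
      · exact Finset.sum_congr rfl fun n _ => by ring
      · rw [div_mul_eq_div_div]
        ring
    | @add g₁ g₂ C₁ C₂ v₁ v₂ _ _ h₁ h₂ =>
      have e : (∑ n ∈ range N, (if n ≡ r [MOD m] then (1 : ℝ) else 0) *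
            ((g₁ n + g₂ n) * ∏ i ∈ s, f i n)) - N / m * ((v₁ + v₂) * ∏ i ∈ s, v i) =
          ((∑ n ∈ range N, (if n ≡ r [MOD m] then (1 : ℝ) else 0) * (g₁ n * ∏ i ∈ s, f i n))
            - N / m * (v₁ * ∏ i ∈ s, v i)) +
          ((∑ n ∈ range N, (if n ≡ r [MOD m] then (1 : ℝ) else 0) * (g₂ n * ∏ i ∈ s, f i n))
            - N / m * (v₂ * ∏ i ∈ s, v i)) := by
        simp only [add_mul, mul_add, Finset.sum_add_distrib]
        ring
      rw [e]
      refine (abs_add_le _ _).trans ?_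
      push_cast
      linarith
    | @sub g₁ g₂ C₁ C₂ v₁ v₂ _ _ h₁ h₂ =>
      have e : (∑ n ∈ range N, (if n ≡ r [MOD m] then (1 : ℝ) else 0) *
            ((g₁ n - g₂ n) * ∏ i ∈ s, f i n)) - N / m * ((v₁ - v₂) * ∏ i ∈ s, v i) =
          ((∑ n ∈ range N, (if n ≡ r [MOD m] then (1 : ℝ) else 0) * (g₁ n * ∏ i ∈ s, f i n))
            - N / m * (v₁ * ∏ i ∈ s, v i)) -
          ((∑ n ∈ range N, (if n ≡ r [MOD m] then (1 : ℝ) else 0) * (g₂ n * ∏ i ∈ s, f i n))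
            - N / m * (v₂ * ∏ i ∈ s, v i)) := by
        simp only [sub_mul, mul_sub, Finset.sum_sub_distrib]
        ring
      rw [e]
      refine (abs_sub _ _).trans ?_
      push_cast
      linarith

/-- The integer whose base-`p` digits are the lowest `K` digits of `n` in reversed order. -/
def digitRev (p : ℕ) : ℕ → ℕ → ℕ
  | 0, _ => 0
  | K + 1, n => p * digitRev p K n + n / p ^ K % p

theorem digitRev_lt {p : ℕ} (hp : 0 < p) (K n : ℕ) : digitRev p K n < p ^ K := by
  induction K with
  | zero => simp [digitRev]
  | succ K ih =>
    have h := Nat.mod_lt (n / p ^ K) hp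
    rw [digitRev, pow_succ]
    nlinarith

theorem radInv_eq_digitRev_div {p K n : ℕ} (hp : 0 < p) (hn : n < p ^ K) :
    radInv p n = digitRev p K n / (p : ℝ) ^ K := by
  have hp' : (p : ℝ) ≠ 0 := by exact_mod_cast hp.ne'
  have h : ∀ K : ℕ, ∑ i ∈ range K, (((n / p ^ i) % p : ℕ) : ℝ) / (p : ℝ) ^ (i + 1) =
      digitRev p K n / (p : ℝ) ^ K := by
    intro K
    induction K with
    | zero => simp [digitRev]
    | succ K ih =>
      rw [Finset.sum_range_succ, ih, digitRev]
      push_cast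
      field_simp
      ring
  rw [radInv, tsum_eq_sum (s := range K), h]
  intro i hi
  have : n / p ^ i = 0 :=
    Nat.div_eq_of_lt (hn.trans_le (Nat.pow_le_pow_right hp (by simpa using hi)))
  simp [this]

theorem exists_digitRev_eq_iff_modEq {p : ℕ} (hp : 0 < p) (K : ℕ) :
    ∀ c < p ^ K, ∃ r, ∀ n, digitRev p K n = c ↔ n ≡ r [MOD p ^ K] := by
  induction K with
  | zero =>
    intro c hc
    exact ⟨0, fun n => by simp [digitRev, Nat.modEq_one]; simp at hc; omega⟩
  | succ K ih =>
    intro c hc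
    have hc' : c / p < p ^ K := by
      rw [Nat.div_lt_iff_lt_mul hp, ← pow_succ]
      exact hc
    obtain ⟨r, hr⟩ := ih (c / p) hc'
    have hpK : 0 < p ^ K := pow_pos hp K
    refine ⟨r % p ^ K + p ^ K * (c % p), fun n => ?_⟩
    have h1 : digitRev p (K + 1) n = c ↔ digitRev p K n = c / p ∧ n / p ^ K % p = c % p := by
      have hlt := Nat.mod_lt (n / p ^ K) hp
      have hdiv : (p * digitRev p K n + n / p ^ K % p) / p = digitRev p K n := by
        rw [Nat.mul_add_div hp, Nat.div_eq_of_lt hlt, add_zero]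
      have hmod : (p * digitRev p K n + n / p ^ K % p) % p = n / p ^ K % p := by
        rw [Nat.mul_add_mod, Nat.mod_mod]
      rw [digitRev]
      constructor
      · intro h
        rw [← h, hdiv, hmod]
        exact ⟨rfl, rfl⟩
      · rintro ⟨h, h'⟩
        rw [h, h', Nat.div_add_mod]
    have hdiv : (r % p ^ K + p ^ K * (c % p)) / p ^ K = c % p := by
      rw [Nat.add_mul_div_left _ _ hpK, Nat.div_eq_of_lt (Nat.mod_lt _ hpK), zero_add]
    have hmod : (r % p ^ K + p ^ K * (c % p)) % p ^ K = r % p ^ K := by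
      rw [Nat.add_mul_mod_self_left, Nat.mod_mod]
    rw [h1, hr]
    unfold Nat.ModEq
    rw [Nat.mod_pow_succ, Nat.mod_pow_succ, hdiv, hmod, Nat.mod_mod]
    constructor
    · rintro ⟨h, h'⟩
      rw [h, h']
    · intro h
      have e1 := congrArg (· % p ^ K) h
      have e2 := congrArg (· / p ^ K) h
      simp only [Nat.add_mul_mod_self_left, Nat.mod_mod] at e1
      simp only [Nat.add_mul_div_left _ _ hpK, Nat.div_eq_of_lt (Nat.mod_lt _ hpK), zero_add] at e2
      exact ⟨e1, e2⟩

theorem residueComb_digitRev_lt {p : ℕ} (hp : 0 < p) (K : ℕ) :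
    ∀ B ≤ p ^ K, ∃ C ≤ (p - 1) * K + 1,
      ResidueComb p (fun n => if digitRev p K n < B then 1 else 0) C (B / (p : ℝ) ^ K) := by
  have hp' : (p : ℝ) ≠ 0 := by exact_mod_cast hp.ne'
  induction K with
  | zero =>
    intro B hB
    obtain rfl | rfl : B = 0 ∨ B = 1 := by simp at hB; omega
    · exact ⟨0, by simp, by simpa using ResidueComb.zero⟩
    · exact ⟨1, by simp, by simpa [digitRev, Nat.modEq_one] using ResidueComb.atom (p := p) 0 0⟩
  | succ K ih =>
    have step : ∀ q t, t < p → p * q + t ≤ p ^ (K + 1) → ∃ C ≤ (p - 1) * K + 1 + t,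
        ResidueComb p (fun n => if digitRev p (K + 1) n < p * q + t then 1 else 0) C
          (((p * q + t : ℕ) : ℝ) / (p : ℝ) ^ (K + 1)) := by
      intro q t
      induction t with
      | zero =>
        intro _ hle
        have hq : q ≤ p ^ K := by
          rw [pow_succ, mul_comm (p ^ K)] at hle
          exact Nat.le_of_mul_le_mul_left hle hp
        obtain ⟨C, hC, h⟩ := ih q hq
        refine ⟨C, hC, ?_⟩
        convert h using 1
        · funext n
          congr 1
          have hlt := Nat.mod_lt (n / p ^ K) hp
          rw [digitRev, add_zero, eq_iff_iff]
          constructor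
          · intro h
            by_contra hcon
            have := Nat.mul_le_mul_left p (not_lt.1 hcon)
            omega
          · intro h
            have := Nat.mul_le_mul_left p (Nat.succ_le_of_lt h)
            rw [Nat.succ_eq_add_one, mul_add, mul_one] at this
            omega
        · push_cast
          field_simp
          ring
      | succ t iht =>
        intro ht hle
        obtain ⟨C, hC, h⟩ := iht (by omega) (by omega)
        obtain ⟨r, hr⟩ := exists_digitRev_eq_iff_modEq hp (K + 1) (p * q + t) (by omega)
        refine ⟨C + 1, by omega, ?_⟩
        convert h.add (ResidueComb.atom (K + 1) r) using 1
        · funext n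
          simp only [← hr]
          split_ifs <;> first | omega | norm_num
        · push_cast
          field_simp
          ring
    intro B hB
    have hlt := Nat.mod_lt B hp
    obtain ⟨C, hC, h⟩ := step (B / p) (B % p) hlt (by rwa [Nat.div_add_mod])
    refine ⟨C, ?_, by rwa [Nat.div_add_mod] at h⟩
    have : (p - 1) * (K + 1) = (p - 1) * K + (p - 1) := by ring
    omega

/-- The indicator of an interval, evaluated along the van der Corput sequence. -/
theorem exists_residueComb_radInv {p K : ℕ} (hp : 0 < p) (hK : 0 < K) {a b : ℝ}
    (ha : 0 ≤ a) (hab : a ≤ b) (hb : b ≤ 1) :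
    ∃ f C v, ResidueComb p f C v ∧ C ≤ 2 * p * K ∧ 0 ≤ v ∧ v ≤ 1 ∧
      |v - (b - a)| ≤ 1 / (p : ℝ) ^ K ∧
      ∀ n < p ^ K, f n = if a ≤ radInv p n ∧ radInv p n < b then 1 else 0 := by
  have hpK : (0 : ℝ) < (p : ℝ) ^ K := by positivity
  have hb0 : 0 ≤ b := ha.trans hab
  have hAB : ⌈a * p ^ K⌉₊ ≤ ⌈b * p ^ K⌉₊ := Nat.ceil_mono (by gcongr)
  have hB : ⌈b * (p : ℝ) ^ K⌉₊ ≤ p ^ K := by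
    rw [Nat.ceil_le]
    push_cast
    nlinarith
  obtain ⟨C, hC, h⟩ := residueComb_digitRev_lt hp K _ hB
  obtain ⟨D, hD, h'⟩ := residueComb_digitRev_lt hp K _ (hAB.trans hB)
  have hABr : (⌈a * (p : ℝ) ^ K⌉₊ : ℝ) ≤ ⌈b * (p : ℝ) ^ K⌉₊ := by exact_mod_cast hAB
  have hBr : (⌈b * (p : ℝ) ^ K⌉₊ : ℝ) ≤ (p : ℝ) ^ K := by exact_mod_cast hB
  have ha1 := Nat.le_ceil (a * (p : ℝ) ^ K)
  have ha2 := Nat.ceil_lt_add_one (a := a * (p : ℝ) ^ K) (by positivity)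
  have hb1 := Nat.le_ceil (b * (p : ℝ) ^ K)
  have hb2 := Nat.ceil_lt_add_one (a := b * (p : ℝ) ^ K) (by positivity)
  have hA0 : (0 : ℝ) ≤ ⌈a * (p : ℝ) ^ K⌉₊ := by positivity
  refine ⟨_, _, _, h.sub h', ?_, ?_, ?_, ?_, ?_⟩
  · obtain ⟨q, rfl⟩ : ∃ q, p = q + 1 := ⟨p - 1, by omega⟩
    rw [Nat.add_sub_cancel] at hC hD
    nlinarith
  · rw [← sub_div]
    exact div_nonneg (by linarith) hpK.le
  · rw [← sub_div, div_le_one hpK]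
    linarith
  · have : ∀ x y : ℝ, x / (p : ℝ) ^ K - y / (p : ℝ) ^ K - (b - a) =
        ((x - b * (p : ℝ) ^ K) - (y - a * (p : ℝ) ^ K)) / (p : ℝ) ^ K := by
      intro x y
      field_simp
      ring
    rw [this, abs_div, abs_of_pos hpK]
    gcongr
    rw [abs_le]
    constructor <;> linarith
  · intro n hn
    have e1 : a ≤ radInv p n ↔ ⌈a * (p : ℝ) ^ K⌉₊ ≤ digitRev p K n := by
      rw [radInv_eq_digitRev_div hp hn, le_div_iff₀ hpK, Nat.ceil_le]
    have e2 : radInv p n < b ↔ digitRev p K n < ⌈b * (p : ℝ) ^ K⌉₊ := by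
      rw [radInv_eq_digitRev_div hp hn, div_lt_iff₀ hpK, Nat.lt_ceil]
    simp only [e1, e2]
    by_cases hx : digitRev p K n < ⌈b * (p : ℝ) ^ K⌉₊ <;>
      by_cases hy : digitRev p K n < ⌈a * (p : ℝ) ^ K⌉₊
    · simp only [hx, hy, not_le.2 hy, if_true, false_and, if_false, sub_self]
    · simp [hx, hy, not_lt.1 hy]
    · omega
    · simp [hx, hy]

theorem abs_prod_sub_prod_le_sum {ι : Type} (s : Finset ι) {v w : ι → ℝ}
    (hv : ∀ i, 0 ≤ v i ∧ v i ≤ 1) (hw : ∀ i, 0 ≤ w i ∧ w i ≤ 1) :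
    |∏ i ∈ s, v i - ∏ i ∈ s, w i| ≤ ∑ i ∈ s, |v i - w i| := by
  classical
  induction s using Finset.induction_on with
  | empty => simp
  | insert a s ha ih =>
    rw [Finset.prod_insert ha, Finset.prod_insert ha, Finset.sum_insert ha]
    have hV0 : 0 ≤ ∏ i ∈ s, v i := Finset.prod_nonneg fun i _ => (hv i).1
    have hV1 : ∏ i ∈ s, v i ≤ 1 := Finset.prod_le_one (fun i _ => (hv i).1) fun i _ => (hv i).2
    have e : v a * ∏ i ∈ s, v i - w a * ∏ i ∈ s, w i =
        (v a - w a) * ∏ i ∈ s, v i + w a * (∏ i ∈ s, v i - ∏ i ∈ s, w i) := by ring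
    rw [e]
    refine (abs_add_le _ _).trans ?_
    rw [abs_mul, abs_mul, abs_of_nonneg hV0, abs_of_nonneg (hw a).1]
    have h1 := mul_le_mul_of_nonneg_left hV1 (abs_nonneg (v a - w a))
    have h2 := mul_le_mul_of_nonneg_right (hw a).2 (abs_nonneg (∏ i ∈ s, v i - ∏ i ∈ s, w i))
    linarith

theorem unanchoredDisc_radInv_le {ι : Type} [Fintype ι] {p K : ι → ℕ}
    (hp : ∀ i, 0 < p i) (hcop : Pairwise fun i j => (p i).Coprime (p j)) (hK : ∀ i, 0 < K i)
    {N : ℕ} (hN : 0 < N) (hNK : ∀ i, N ≤ p i ^ K i) :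
    unanchoredDisc N (fun (n : Fin N) i => radInv (p i) n) ≤ (∏ i, (4 * p i * K i : ℝ)) / N := by
  classical
  have hN' : (0 : ℝ) < N := by exact_mod_cast hN
  refine Real.sSup_le ?_ (by positivity)
  rintro t ⟨a, b, hab, rfl⟩
  choose f C v hf hC hv0 hv1 hv hfn using fun i =>
    exists_residueComb_radInv (hp i) (hK i) (hab i).1 (hab i).2.1 (hab i).2.2
  have hcount : ((Finset.univ.filter fun n : Fin N =>
      ∀ i, a i ≤ radInv (p i) n ∧ radInv (p i) n < b i).card : ℝ) =
      ∑ n ∈ range N, ∏ i, f i n := by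
    rw [← Finset.sum_boole, ← Fin.sum_univ_eq_sum_range (fun n => ∏ i, f i n)]
    refine Finset.sum_congr rfl fun n _ => ?_
    rw [Finset.prod_congr rfl fun i _ => hfn i n (n.2.trans_le (hNK i)), Finset.prod_boole]
    simp
  have hmain := ResidueComb.abs_sum_prod_sub_le hp hcop hf N univ 1 0 one_pos (by simp)
  simp only [Nat.modEq_one, if_true, one_mul, Nat.cast_one, div_one] at hmain
  have hvol : |∏ i, v i - ∏ i, (b i - a i)| ≤ Fintype.card ι / N := by
    refine (abs_prod_sub_prod_le_sum univ (fun i => ⟨hv0 i, hv1 i⟩) (fun i => ?_)).trans ?_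
    · have := hab i
      exact ⟨by linarith, by linarith⟩
    · refine (Finset.sum_le_card_nsmul _ _ (1 / (N : ℝ)) fun i _ => (hv i).trans ?_).trans ?_
      · have : (N : ℝ) ≤ (p i : ℝ) ^ K i := by exact_mod_cast hNK i
        gcongr
      · simp [div_eq_mul_inv]
  have hCle : ∏ i, (C i : ℝ) ≤ ∏ i, (2 * p i * K i : ℝ) :=
    Finset.prod_le_prod (fun i _ => by positivity) fun i _ => by exact_mod_cast hC i
  have hone : 1 ≤ ∏ i, (2 * p i * K i : ℝ) := by
    have : 1 ≤ ∏ i, (2 * p i * K i) :=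
      Finset.prod_pos fun i _ => Nat.mul_pos (Nat.mul_pos two_pos (hp i)) (hK i)
    exact_mod_cast this
  have hcard : (Fintype.card ι : ℝ) + 1 ≤ 2 ^ Fintype.card ι := by
    exact_mod_cast Nat.succ_le_of_lt (Nat.lt_two_pow_self (n := Fintype.card ι))
  have hfour : ∏ i, (4 * p i * K i : ℝ) = 2 ^ Fintype.card ι * ∏ i, (2 * p i * K i : ℝ) := by
    rw [← Finset.card_univ, ← Finset.prod_const, ← Finset.prod_mul_distrib]
    exact Finset.prod_congr rfl fun i _ => by ring
  rw [hcount]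
  have e : (∑ n ∈ range N, ∏ i, f i n) / (N : ℝ) - ∏ i, (b i - a i) =
      ((∑ n ∈ range N, ∏ i, f i n) - N * ∏ i, v i) / N + (∏ i, v i - ∏ i, (b i - a i)) := by
    field_simp
    ring
  rw [e]
  refine (abs_add_le _ _).trans ?_
  rw [abs_div, abs_of_pos hN']
  refine (add_le_add (div_le_div_of_nonneg_right (hmain.trans hCle) hN'.le) hvol).trans ?_
  rw [← add_div, hfour]
  gcongr
  nlinarith [Nat.cast_nonneg (α := ℝ) (Fintype.card ι)]

/-- Chebyshev's bound `p_j ≪ j log p_j` for the primes. -/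
theorem nth_prime_le_mul_log (j : ℕ) :
    (Nat.nth Nat.Prime j : ℝ) ≤ 5 * (j + 1) * Real.log (Nat.nth Nat.Prime j) := by
  set p := Nat.nth Nat.Prime j with hpdef
  have hp : 2 ≤ p := (Nat.prime_nth_prime j).two_le
  have hp' : (2 : ℝ) ≤ p := by exact_mod_cast hp
  have hlog : 0 < Real.log p := Real.log_pos (by linarith)
  have hpi : Nat.primeCounting p = j + 1 := by
    rw [Nat.primeCounting, Nat.primeCounting', Nat.count_succ, hpdef,
      Nat.count_nth_of_infinite Nat.infinite_setOfPred_prime]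
    simp [Nat.prime_nth_prime]
  have h := Chebyshev.pi_ge p
  rw [hpi, div_le_iff₀ hlog] at h
  push_cast at h
  have hlog1 : Real.log (p + 1) ≤ 2 * Real.log p := by
    rw [← Real.log_rpow (by linarith)]
    refine Real.log_le_log (by linarith) ?_
    norm_num
    nlinarith
  have h2 := Real.log_two_gt_d9
  have hj : (0 : ℝ) ≤ j := j.cast_nonneg
  have h3 : (p : ℝ) * 0.6 ≤ p * Real.log 2 := by gcongr; linarith
  nlinarith [mul_nonneg hj hlog.le]

/-- A product `∏ (1 + B_j L)` with summable `B` grows subexponentially in `L`, uniformly over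
finite sub-products. -/
theorem exists_prod_one_add_mul_le_exp {B : ℕ → ℝ} (hB0 : ∀ j, 0 ≤ B j) (hB : Summable B)
    {δ : ℝ} (hδ : 0 < δ) :
    ∃ c : ℝ, 0 < c ∧ ∀ (s : Finset ℕ) (L : ℝ), 0 ≤ L →
      ∏ j ∈ s, (1 + B j * L) ≤ c * Real.exp (δ * L) := by
  obtain ⟨T, hT⟩ := summable_iff_vanishing_norm.1 hB (δ / 2) (by positivity)
  set η : ℝ := δ / (2 * (T.card + 1)) with hη
  have hη0 : 0 < η := by positivity
  refine ⟨∏ j ∈ T, (1 + B j / η), Finset.prod_pos fun j _ => by have := hB0 j; positivity, ?_⟩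
  intro s L hL
  have hone : ∀ j, 1 ≤ 1 + B j * L := fun j => by have := mul_nonneg (hB0 j) hL; linarith
  have hfin : ∏ j ∈ s ∩ T, (1 + B j * L) ≤
      (∏ j ∈ T, (1 + B j / η)) * Real.exp (δ / 2 * L) := by
    calc ∏ j ∈ s ∩ T, (1 + B j * L) ≤ ∏ j ∈ T, (1 + B j * L) :=
          Finset.prod_le_prod_of_subset_of_one_le inter_subset_right
            (fun j _ => by linarith [hone j]) (fun j _ _ => hone j)
      _ ≤ ∏ j ∈ T, ((1 + B j / η) * Real.exp (η * L)) := by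
          refine Finset.prod_le_prod (fun j _ => by linarith [hone j]) fun j _ => ?_
          have h1 := Real.add_one_le_exp (η * L)
          have h2 : 0 ≤ B j / η := div_nonneg (hB0 j) hη0.le
          have h3 : B j * L = B j / η * (η * L) := by field_simp
          calc 1 + B j * L ≤ (1 + B j / η) * (η * L + 1) := by
                rw [h3]
                nlinarith [mul_nonneg hη0.le hL]
            _ ≤ _ := by gcongr
      _ = (∏ j ∈ T, (1 + B j / η)) * Real.exp (T.card * (η * L)) := by
          rw [Finset.prod_mul_distrib, Finset.prod_const, Real.exp_nat_mul]
      _ ≤ _ := by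
          have hc : (T.card : ℝ) * η ≤ δ / 2 := by
            rw [hη, mul_div_assoc', div_le_div_iff₀ (by positivity) two_pos]
            nlinarith
          have hnn : 0 ≤ ∏ j ∈ T, (1 + B j / η) :=
            Finset.prod_nonneg fun j _ => by have := hB0 j; positivity
          rw [← mul_assoc]
          gcongr
  have htail : ∏ j ∈ s \ T, (1 + B j * L) ≤ Real.exp (δ / 2 * L) := by
    calc ∏ j ∈ s \ T, (1 + B j * L) ≤ ∏ j ∈ s \ T, Real.exp (B j * L) :=
          Finset.prod_le_prod (fun j _ => by linarith [hone j]) fun j _ => by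
            linarith [Real.add_one_le_exp (B j * L)]
      _ = Real.exp ((∑ j ∈ s \ T, B j) * L) := by rw [← Real.exp_sum, Finset.sum_mul]
      _ ≤ _ := by
          have := (le_abs_self _).trans (hT (s \ T) sdiff_disjoint).le
          gcongr
  rw [← Finset.prod_inter_mul_prod_sdiff s T]
  calc _ ≤ (∏ j ∈ T, (1 + B j / η)) * Real.exp (δ / 2 * L) * Real.exp (δ / 2 * L) :=
        mul_le_mul hfin htail (Finset.prod_nonneg fun j _ => by linarith [hone j])
          (Finset.prod_nonneg (fun j _ => by linarith [hone j]) |>.trans hfin)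
    _ = _ := by
        rw [mul_assoc, ← Real.exp_add, ← add_mul, add_halves]

/-- For monotone weights with `∑ j γ_j < ∞`, the products `4 p_j γ_j` are eventually at most `1`. -/
theorem eventually_nth_prime_mul_le_one {γ : ℕ → ℝ} (hpos : ∀ j : ℕ, 1 ≤ j → 0 < γ j)
    (hmono : ∀ j : ℕ, 1 ≤ j → γ (j + 1) ≤ γ j)
    (hsum : Summable fun j : ℕ => (j : ℝ) * γ j) :
    ∀ᶠ j : ℕ in Filter.atTop, 4 * (Nat.nth Nat.Prime j : ℝ) * γ (j + 1) ≤ 1 := by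
  set S := ∑' j : ℕ, (j : ℝ) * γ j
  have hnn : ∀ j : ℕ, 0 ≤ (j : ℝ) * γ j := by
    intro j
    rcases Nat.eq_zero_or_pos j with rfl | h
    · simp
    · exact mul_nonneg j.cast_nonneg (hpos j h).le
  have hanti : ∀ i j : ℕ, 1 ≤ i → i ≤ j → γ j ≤ γ i := by
    intro i j hi hij
    induction j, hij using Nat.le_induction with
    | base => exact le_rfl
    | succ k hk ih => exact (hmono k (hi.trans hk)).trans ih
  have hγ : ∀ j : ℕ, ((j : ℝ) + 1) ^ 2 * γ (j + 1) ≤ 2 * S := by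
    intro j
    have h1 : ∑ i ∈ range (j + 2), (i : ℝ) * γ (j + 1) ≤ S := by
      refine (Finset.sum_le_sum fun i hi => ?_).trans (hsum.sum_le_tsum (range (j + 2))
        fun i _ => hnn i)
      rcases Nat.eq_zero_or_pos i with rfl | h
      · simp
      · exact mul_le_mul_of_nonneg_left (hanti i (j + 1) h (by simp at hi; omega)) i.cast_nonneg
    rw [← Finset.sum_mul] at h1
    have h2 : (∑ i ∈ range (j + 2), (i : ℝ)) * 2 = (j + 2) * (j + 1) := by
      have := Finset.sum_range_id_mul_two (j + 2)
      have h3 : ((∑ i ∈ range (j + 2), i : ℕ) : ℝ) * 2 = ((j + 2) * (j + 2 - 1) : ℕ) := by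
        exact_mod_cast this
      simpa using h3
    have := hpos (j + 1) (by omega)
    have hj : (0 : ℝ) ≤ j := j.cast_nonneg
    nlinarith [mul_nonneg hj this.le]
  have hS : 0 ≤ S := tsum_nonneg hnn
  have hlim : Filter.Tendsto (fun j => (Nat.nth Nat.Prime j : ℝ)) Filter.atTop Filter.atTop :=
    tendsto_natCast_atTop_atTop.comp
      (Nat.nth_strictMono Nat.infinite_setOfPred_prime).tendsto_atTop
  have ho := (Real.isLittleO_pow_log_id_atTop (n := 2)).bound
    (show (0 : ℝ) < 1 / (200 * S + 1) by positivity)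
  filter_upwards [hlim.eventually ho] with j hj
  set p : ℝ := (Nat.nth Nat.Prime j : ℝ)
  have hp : 0 < p := Nat.cast_pos.2 (Nat.prime_nth_prime j).pos
  have hch : p ≤ 5 * (j + 1) * Real.log p := nth_prime_le_mul_log j
  simp only [id, Real.norm_eq_abs, abs_pow, sq_abs, abs_of_pos hp] at hj
  rw [div_mul_eq_mul_div, one_mul, le_div_iff₀ (by positivity)] at hj
  have h1 : p ^ 2 ≤ 25 * Real.log p ^ 2 * ((j : ℝ) + 1) ^ 2 := by
    calc p ^ 2 ≤ (5 * (j + 1) * Real.log p) ^ 2 := by gcongr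
      _ = _ := by ring
  have hg := (hpos (j + 1) (by omega)).le
  have h2 : p ^ 2 * γ (j + 1) ≤ 25 * Real.log p ^ 2 * (2 * S) := by
    calc p ^ 2 * γ (j + 1) ≤ 25 * Real.log p ^ 2 * ((j : ℝ) + 1) ^ 2 * γ (j + 1) := by gcongr
      _ = 25 * Real.log p ^ 2 * (((j : ℝ) + 1) ^ 2 * γ (j + 1)) := by ring
      _ ≤ _ := mul_le_mul_of_nonneg_left (hγ j) (by positivity)
  have h3 : p * (4 * p * γ (j + 1)) ≤ p * 1 := by nlinarith [sq_nonneg (Real.log p)]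
  exact le_of_mul_le_mul_left h3 hp

theorem clog_le_two_mul_log_div {p N : ℕ} (hp : 2 ≤ p) (hpN : p ≤ N) :
    (Nat.clog p N : ℝ) ≤ 2 * (Real.log N / Real.log p) := by
  have hp' : (2 : ℝ) ≤ p := by exact_mod_cast hp
  have hN : 0 < N := by omega
  have hlog : 0 < Real.log p := Real.log_pos (by linarith)
  have h1 : (Nat.log p N : ℝ) ≤ Real.log N / Real.log p := by
    rw [le_div_iff₀ hlog, ← Real.log_pow]
    refine Real.log_le_log (by positivity) ?_
    exact_mod_cast Nat.pow_log_le_self p hN.ne'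
  have h2 : Nat.clog p N ≤ Nat.log p N + 1 :=
    Nat.clog_le_of_le_pow (Nat.lt_pow_succ_log_self hp N).le
  have h3 : 1 ≤ Real.log N / Real.log p := by
    rw [one_le_div hlog]
    exact Real.log_le_log (by linarith) (by exact_mod_cast hpN)
  have h4 : (Nat.clog p N : ℝ) ≤ Nat.log p N + 1 := by exact_mod_cast h2
  linarith

/-- If `∑_{j≥1} j·γ_j < ∞`, then for every `δ ∈ (0,1)` there is `c_δ > 0` with
`D_{N,γ}(H_{d,N}) = max_{∅≠u⊆[d]} γ_u·D_N(H_{d,N}(u)) ≤ c_δ / N^{1−δ}`. -/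
theorem halton_weighted_unanch_disc_bound
    (γ : ℕ → ℝ) (hpos : ∀ j : ℕ, 1 ≤ j → 0 < γ j)
    (hmono : ∀ j : ℕ, 1 ≤ j → γ (j + 1) ≤ γ j)
    (hsum : Summable fun j : ℕ => (j : ℝ) * γ j) :
    ∀ δ : ℝ, 0 < δ → δ < 1 → ∃ c : ℝ, 0 < c ∧
      ∀ d : ℕ, 1 ≤ d → ∀ N : ℕ, 2 ≤ N →
        wHaltonUnanchDisc γ d N ≤ c / (N : ℝ) ^ (1 - δ) := by
  intro δ hδ _
  set p : ℕ → ℕ := Nat.nth Nat.Prime with hpdef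
  have hprime : ∀ j, (p j).Prime := Nat.prime_nth_prime
  set G : ℕ → ℝ := fun j => 4 * p j * γ (j + 1) with hG
  set B : ℕ → ℝ := fun j => 40 * (((j + 1 : ℕ) : ℝ) * γ (j + 1)) with hB
  have hγ : ∀ j, 0 ≤ γ (j + 1) := fun j => (hpos _ (by omega)).le
  have hB0 : ∀ j, 0 ≤ B j := fun j => by have := hγ j; positivity
  have hBsum : Summable B :=
    ((summable_nat_add_iff (f := fun j : ℕ => (j : ℝ) * γ j) 1).2 hsum).mul_left 40
  obtain ⟨c, hc, hprod⟩ := exists_prod_one_add_mul_le_exp hB0 hBsum hδ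
  obtain ⟨J, hJ⟩ := Filter.eventually_atTop.1 (eventually_nth_prime_mul_le_one hpos hmono hsum)
  set M : ℝ := ∏ j ∈ range J, max 1 (G j) with hM
  have hM0 : 0 < M := Finset.prod_pos fun j _ => lt_max_of_lt_left one_pos
  refine ⟨c * M, by positivity, ?_⟩
  intro d _ N hN
  have hN' : (0 : ℝ) < N := by exact_mod_cast (by omega : 0 < N)
  have hL : 0 ≤ Real.log N := Real.log_natCast_nonneg N
  have hfactor : ∀ j, γ (j + 1) * (4 * p j * Nat.clog (p j) N) ≤
      (1 + B j * Real.log N) * max 1 (G j) := by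
    intro j
    have hBL := mul_nonneg (hB0 j) hL
    have hG0 : 0 ≤ G j := by have := hγ j; positivity
    rcases le_or_gt (p j) N with h | h
    · have hlog : 0 < Real.log (p j) := Real.log_pos (by exact_mod_cast (hprime j).one_lt)
      have h1 : (p j : ℝ) * Nat.clog (p j) N ≤ 10 * (j + 1) * Real.log N := by
        calc (p j : ℝ) * Nat.clog (p j) N
            ≤ (5 * (j + 1) * Real.log (p j)) * (2 * (Real.log N / Real.log (p j))) :=
              mul_le_mul (nth_prime_le_mul_log j) (clog_le_two_mul_log_div (hprime j).two_le h)
                (by positivity) (by positivity)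
          _ = _ := by field_simp; ring
      have h2 : γ (j + 1) * (4 * p j * Nat.clog (p j) N) ≤ B j * Real.log N := by
        calc _ = 4 * γ (j + 1) * ((p j : ℝ) * Nat.clog (p j) N) := by ring
          _ ≤ 4 * γ (j + 1) * (10 * (j + 1) * Real.log N) :=
            mul_le_mul_of_nonneg_left h1 (by have := hγ j; positivity)
          _ = _ := by simp only [hB]; push_cast; ring
      nlinarith [le_max_left 1 (G j)]
    · have h1 : Nat.clog (p j) N ≤ 1 := Nat.clog_le_of_le_pow (by simpa using h.le)
      have h1' : (Nat.clog (p j) N : ℝ) ≤ 1 := by exact_mod_cast h1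
      have h2 : γ (j + 1) * (4 * p j * Nat.clog (p j) N) ≤ G j := by
        calc _ = G j * Nat.clog (p j) N := by simp only [hG]; ring
          _ ≤ _ := mul_le_of_le_one_right hG0 h1'
      nlinarith [le_max_left 1 (G j), le_max_right 1 (G j)]
  have hfactor0 : ∀ j, 0 ≤ γ (j + 1) * (4 * p j * Nat.clog (p j) N) :=
    fun j => by have := hγ j; positivity
  have hmax : ∀ s : Finset ℕ, ∏ j ∈ s, max 1 (G j) ≤ M := by
    intro s
    rw [← Finset.prod_inter_mul_prod_sdiff s (range J)]
    have h1 : ∏ j ∈ s \ range J, max 1 (G j) = 1 :=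
      Finset.prod_eq_one fun j hj => max_eq_left (hJ j (by simp at hj; exact hj.2))
    rw [h1, mul_one]
    exact Finset.prod_le_prod_of_subset_of_one_le inter_subset_right
      (fun j _ => zero_le_one.trans (le_max_left _ _)) (fun j _ _ => le_max_left _ _)
  have hexp : Real.exp (δ * Real.log N) = (N : ℝ) ^ δ := by
    rw [Real.rpow_def_of_pos hN', mul_comm]
  have hpow : c * M / (N : ℝ) ^ (1 - δ) = c * (N : ℝ) ^ δ * M / N := by
    rw [Real.rpow_sub hN', Real.rpow_one]
    field_simp
  refine Real.sSup_le ?_ (by positivity)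
  rintro t ⟨u, -, rfl⟩
  have hdisc : haltonProjUnanchDisc d N u ≤
      (∏ j ∈ u, (4 * p j * Nat.clog (p j) N : ℝ)) / N := by
    rw [← Finset.prod_coe_sort]
    refine unanchoredDisc_radInv_le (p := fun j : u => p j) (fun j => (hprime _).pos) ?_
      (fun j => Nat.clog_pos (hprime _).one_lt hN) (by omega)
      (fun j => Nat.le_pow_clog (hprime _).one_lt N)
    intro i j hij
    refine (Nat.coprime_primes (hprime _) (hprime _)).2 fun h => hij ?_
    exact Subtype.ext (Fin.ext (Nat.nth_injective Nat.infinite_setOfPred_prime h))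
  rw [hpow]
  calc (∏ j ∈ u, γ (j.1 + 1)) * haltonProjUnanchDisc d N u
      ≤ (∏ j ∈ u, γ (j.1 + 1)) * ((∏ j ∈ u, (4 * p j * Nat.clog (p j) N : ℝ)) / N) :=
        mul_le_mul_of_nonneg_left hdisc (Finset.prod_nonneg fun j _ => hγ j)
    _ = (∏ j ∈ u.map Fin.valEmbedding, γ (j + 1) * (4 * p j * Nat.clog (p j) N)) / N := by
        rw [mul_div_assoc', ← Finset.prod_mul_distrib, Finset.prod_map]
        rfl
    _ ≤ (∏ j ∈ u.map Fin.valEmbedding, (1 + B j * Real.log N) * max 1 (G j)) / N := by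
        exact div_le_div_of_nonneg_right
          (Finset.prod_le_prod (fun j _ => hfactor0 j) fun j _ => hfactor j) hN'.le
    _ ≤ c * (N : ℝ) ^ δ * M / N := by
        rw [Finset.prod_mul_distrib, ← hexp]
        exact div_le_div_of_nonneg_right (mul_le_mul (hprod _ _ hL) (hmax _)
          (Finset.prod_nonneg fun j _ => zero_le_one.trans (le_max_left _ _))
          (by positivity)) hN'.le
end
end

section
/- Let (x_n)_{n≥0} be a sequence of points in [0,1)^{ℕ} and suppose there is a constant K > 0 such that for every finite nonempty set u ⊂ ℕ of coordinate indices and every integer N ≥ 2 the projected star discrepancy satisfies D*_N(S(u)) ≤ ((log N)^{|u|}/N) · ∏_{j∈u} K·j, where S(u) denotes the point set of projections of x_0,…,x_{N−1} onto the coordinates in u. Let γ_1 ≥ γ_2 ≥ ⋯ be a nonincreasing sequence of positive reals defining product weights γ_u = ∏_{j∈u} γ_j, and suppose ∑_{j≥1} j·γ_j < ∞. Then for every δ ∈ (0,1) there exists a constant c_δ > 0 such that for all d ≥ 1 and N ≥ 2, max_{∅≠u⊆{1,…,d}} γ_u · D*_N(S(u)) ≤ c_δ / N^{1−δ}. -/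
open Finset

noncomputable section

/-- For a nonnegative summable sequence `a`, the finite products of `a j * L` grow
subexponentially in `L`, uniformly in the index set. -/
theorem exists_prod_mul_le_exp {ι : Type*} {a : ι → ℝ} (ha : ∀ j, 0 ≤ a j) (hs : Summable a)
    {δ : ℝ} (hδ : 0 < δ) :
    ∃ c : ℝ, 0 < c ∧ ∀ L : ℝ, 0 ≤ L → ∀ u : Finset ι, ∏ j ∈ u, (a j * L) ≤ c * Real.exp (δ * L) := by
  classical
  obtain ⟨T, hT⟩ := summable_iff_vanishing_norm.1 hs (δ / 2) (by positivity)
  have hA : 0 ≤ ∑' j, a j := tsum_nonneg ha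
  set s : ℝ := δ / (2 * (∑' j, a j + 1)) with hs_def
  have hs0 : 0 < s := by positivity
  have hsA : s * ∑' j, a j ≤ δ / 2 := by
    rw [hs_def, div_mul_eq_mul_div, div_le_div_iff₀ (by positivity) (by positivity)]
    nlinarith
  refine ⟨max 1 s⁻¹ ^ T.card, by positivity, fun L hL u => ?_⟩
  have le_exp (y : ℝ) : y ≤ Real.exp y := by linarith [Real.add_one_le_exp y]
  have head : ∏ j ∈ u ∩ T, (a j * L) ≤ max 1 s⁻¹ ^ T.card * Real.exp (δ / 2 * L) := by
    calc ∏ j ∈ u ∩ T, (a j * L)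
        ≤ ∏ j ∈ u ∩ T, (s⁻¹ * Real.exp (s * a j * L)) := by
          refine prod_le_prod (fun j _ => mul_nonneg (ha j) hL) fun j _ => ?_
          rw [inv_mul_eq_div, le_div_iff₀ hs0]
          linarith [le_exp (s * a j * L)]
      _ = s⁻¹ ^ (u ∩ T).card * Real.exp (s * (∑ j ∈ u ∩ T, a j) * L) := by
          rw [prod_mul_distrib, prod_const, ← Real.exp_sum, mul_sum, sum_mul]
      _ ≤ max 1 s⁻¹ ^ T.card * Real.exp (δ / 2 * L) := by
          refine mul_le_mul ?_ (Real.exp_le_exp.2 (mul_le_mul_of_nonneg_right ?_ hL))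
            (Real.exp_nonneg _) (by positivity)
          · exact (pow_le_pow_left₀ (by positivity) (le_max_right _ _) _).trans
              (pow_le_pow_right₀ (le_max_left _ _) (card_le_card inter_subset_right))
          · exact (mul_le_mul_of_nonneg_left (hs.sum_le_tsum _ fun j _ => ha j) hs0.le).trans hsA
  have tail : ∏ j ∈ u \ T, (a j * L) ≤ Real.exp (δ / 2 * L) := by
    calc ∏ j ∈ u \ T, (a j * L) ≤ ∏ j ∈ u \ T, Real.exp (a j * L) :=
          prod_le_prod (fun j _ => mul_nonneg (ha j) hL) fun j _ => le_exp _
      _ = Real.exp ((∑ j ∈ u \ T, a j) * L) := by rw [← Real.exp_sum, sum_mul]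
      _ ≤ Real.exp (δ / 2 * L) :=
          Real.exp_le_exp.2 (mul_le_mul_of_nonneg_right
            ((le_abs_self _).trans (hT _ sdiff_disjoint).le) hL)
  calc ∏ j ∈ u, (a j * L) = (∏ j ∈ u ∩ T, (a j * L)) * ∏ j ∈ u \ T, (a j * L) :=
        (prod_inter_mul_prod_sdiff u T _).symm
    _ ≤ (max 1 s⁻¹ ^ T.card * Real.exp (δ / 2 * L)) * Real.exp (δ / 2 * L) :=
        mul_le_mul head tail (prod_nonneg fun j _ => mul_nonneg (ha j) hL) (by positivity)
    _ = max 1 s⁻¹ ^ T.card * Real.exp (δ * L) := by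
        rw [mul_assoc, ← Real.exp_add]
        ring_nf

/-- If a sequence `x` in `[0,1)^ℕ` satisfies the projected star-discrepancy bound
`D*_N(S(u)) ≤ ((log N)^{|u|}/N) · ∏_{j∈u} K·j` (coordinates `j` are 0-based, so
coordinate `j` corresponds to the `(j+1)`-st coordinate of the paper), and the
product weights satisfy `∑_{j≥1} j·γ_j < ∞`, then for every `δ ∈ (0,1)` there is
`c_δ > 0` with `max_{∅≠u⊆[d]} γ_u · D*_N(S(u)) ≤ c_δ / N^{1−δ}`. -/
theorem weighted_star_disc_bound_of_proj_disc_bound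
    (x : ℕ → ℕ → ℝ) (hx : ∀ n j, 0 ≤ x n j ∧ x n j < 1)
    (K : ℝ) (hK : 0 < K)
    (hdisc : ∀ u : Finset ℕ, u.Nonempty → ∀ N : ℕ, 2 ≤ N →
      starDisc N (fun n : Fin N => fun i : u => x n i.1) ≤
        (Real.log N) ^ u.card / N * ∏ j ∈ u, (K * ((j + 1 : ℕ) : ℝ)))
    (γ : ℕ → ℝ) (hpos : ∀ j : ℕ, 1 ≤ j → 0 < γ j)
    (hmono : ∀ j : ℕ, 1 ≤ j → γ (j + 1) ≤ γ j)
    (hsum : Summable fun j : ℕ => (j : ℝ) * γ j) :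
    ∀ δ : ℝ, 0 < δ → δ < 1 → ∃ c : ℝ, 0 < c ∧
      ∀ d : ℕ, 1 ≤ d → ∀ N : ℕ, 2 ≤ N →
        ∀ u : Finset ℕ, u.Nonempty → u ⊆ Finset.range d →
          (∏ j ∈ u, γ (j + 1)) * starDisc N (fun n : Fin N => fun i : u => x n i.1) ≤
            c / (N : ℝ) ^ (1 - δ) := by
  intro δ hδ _
  have ha (j : ℕ) : 0 ≤ K * (((j + 1 : ℕ) : ℝ) * γ (j + 1)) := by
    have := hpos (j + 1) (by omega)
    positivity
  obtain ⟨c, hc, hprod⟩ := exists_prod_mul_le_exp ha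
    (((summable_nat_add_iff 1).2 hsum).mul_left K) hδ
  refine ⟨c, hc, fun d _ N hN u hu _ => ?_⟩
  have hN0 : (0 : ℝ) < N := by positivity
  have hlog : 0 ≤ Real.log N := Real.log_natCast_nonneg N
  calc (∏ j ∈ u, γ (j + 1)) * starDisc N (fun n : Fin N => fun i : u => x n i.1)
      ≤ (∏ j ∈ u, γ (j + 1)) *
          ((Real.log N) ^ u.card / N * ∏ j ∈ u, (K * ((j + 1 : ℕ) : ℝ))) :=
        mul_le_mul_of_nonneg_left (hdisc u hu N hN)
          (prod_nonneg fun j _ => (hpos (j + 1) (by omega)).le)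
    _ = (∏ j ∈ u, (K * (((j + 1 : ℕ) : ℝ) * γ (j + 1)) * Real.log N)) / N := by
        simp only [prod_mul_distrib, prod_const]
        ring
    _ ≤ c * Real.exp (δ * Real.log N) / N :=
        div_le_div_of_nonneg_right (hprod _ hlog u) hN0.le
    _ = c / (N : ℝ) ^ (1 - δ) := by
        rw [Real.rpow_sub hN0, Real.rpow_one, Real.rpow_def_of_pos hN0, mul_comm δ, div_div_eq_mul_div]
end
end
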